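/- Let μ* be an upper quasi-density on ℕ, and let X ⊆ Y ⊆ ℕ, where Y is (up to a finite symmetric difference) a finite union of arithmetic progressions of ℕ, i.e., there exist a positive integer k and a set ℋ ⊆ {0, 1, …, k−1} such that the symmetric difference of Y and ⋃_{h ∈ ℋ}(k·ℕ + h) is finite. Then μ*(X) ≤ μ*(Y). -/

import Mathlib

/-- `k·X + h = {k*x + h : x ∈ X}` -/
def affImage (k h : ℕ) (X : Set ℕ) : Set ℕ := (fun x => k * x + h) '' X

section UpperQuasiDensity

variable {μ : Set ℕ → ℝ}

lemma subadditive_nonneg (h3 : ∀ X Y : Set ℕ, μ (X ∪ Y) ≤ μ X + μ Y) (X : Set ℕ) : 0 ≤ μ X := by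
  have := h3 X X
  rw [Set.union_self] at this
  linarith

/-- An upper quasi-density vanishes on finite sets. -/
lemma upperQuasiDensity_finite
    (h3 : ∀ X Y : Set ℕ, μ (X ∪ Y) ≤ μ X + μ Y)
    (h4 : ∀ (X : Set ℕ) (h k : ℕ), 0 < h → 0 < k →
      μ (affImage k h X) = (1 / (k : ℝ)) * μ X)
    {F : Set ℕ} (hF : F.Finite) : μ F = 0 := by
  have empty : μ ∅ = 0 := by
    have := h4 ∅ 1 2 one_pos two_pos
    simp only [affImage, Set.image_empty] at this
    norm_num at this
    linarith
  have shift : ∀ n, 0 < n → μ {n} = μ {0} := fun n hn => by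
    simpa [affImage] using h4 {0} n 1 hn one_pos
  have zero : μ {0} = 0 := by
    have h := h4 {0} 1 2 one_pos two_pos
    simp only [affImage, Set.image_singleton] at h
    norm_num at h
    linarith [shift 1 one_pos]
  induction F, hF using Set.Finite.induction_on with
  | empty => exact empty
  | @insert a s _ _ ih =>
    have ha : μ {a} = 0 := by
      rcases Nat.eq_zero_or_pos a with rfl | h
      · exact zero
      · rw [shift a h, zero]
    have := h3 {a} s
    rw [Set.singleton_union] at this
    linarith [subadditive_nonneg h3 (insert a s)]

lemma upperQuasiDensity_inter_residue_le
    (h2 : ∀ X : Set ℕ, μ X ≤ 1)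
    (h3 : ∀ X Y : Set ℕ, μ (X ∪ Y) ≤ μ X + μ Y)
    (h4 : ∀ (X : Set ℕ) (h k : ℕ), 0 < h → 0 < k →
      μ (affImage k h X) = (1 / (k : ℝ)) * μ X)
    {k : ℕ} (hk : 0 < k) (a : ℕ) (X : Set ℕ) :
    μ (X ∩ {n | n % k = a}) ≤ 1 / k := by
  set P := X ∩ {n | n % k = a}
  have hsplit : P = (P ∩ {a}) ∪ affImage k (a + k) {x | k * x + (a + k) ∈ P} := by
    ext n
    simp only [affImage, Set.mem_union, Set.mem_inter_iff, Set.mem_singleton_iff, Set.mem_image,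
      Set.mem_ofPred_eq]
    constructor
    · intro hn
      have hmod : n % k = a := hn.2
      have hdiv := Nat.div_add_mod n k
      rcases hq : n / k with _ | q
      · rw [hq] at hdiv
        exact Or.inl ⟨hn, by omega⟩
      · have hx : k * q + (a + k) = n := by
          rw [hq, Nat.mul_succ] at hdiv
          omega
        exact Or.inr ⟨q, by rwa [hx], hx⟩
    · rintro (⟨hn, -⟩ | ⟨x, hx, rfl⟩)
      · exact hn
      · exact hx
  have hfin : μ (P ∩ {a}) = 0 :=
    upperQuasiDensity_finite h3 h4 ((Set.finite_singleton a).inter_of_right P)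
  have hle := h3 (P ∩ {a}) (affImage k (a + k) {x | k * x + (a + k) ∈ P})
  rw [← hsplit, hfin, h4 _ _ _ (by omega) hk] at hle
  have hkk : (0 : ℝ) ≤ 1 / k := by positivity
  have := mul_le_of_le_one_right hkk (h2 {x | k * x + (a + k) ∈ P})
  linarith

/-- A set that is almost contained in the union of the residue classes in `H` modulo `k` has
upper quasi-density at most `H.card / k`. -/
lemma upperQuasiDensity_le_card_div
    (h2 : ∀ X : Set ℕ, μ X ≤ 1)
    (h3 : ∀ X Y : Set ℕ, μ (X ∪ Y) ≤ μ X + μ Y)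
    (h4 : ∀ (X : Set ℕ) (h k : ℕ), 0 < h → 0 < k →
      μ (affImage k h X) = (1 / (k : ℝ)) * μ X)
    {k : ℕ} (hk : 0 < k) (H : Finset ℕ) (X : Set ℕ) (hX : (X \ {n | n % k ∈ H}).Finite) :
    μ X ≤ H.card / k := by
  induction H using Finset.induction_on generalizing X with
  | empty =>
    have : X.Finite := by simpa using hX
    simp [upperQuasiDensity_finite h3 h4 this]
  | insert a s ha ih =>
    have hrest := ih (X \ {n | n % k = a}) (hX.subset fun n hn => by
      simp only [Set.mem_sdiff, Set.mem_ofPred_eq, Finset.mem_insert] at hn ⊢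
      tauto)
    have hpiece := upperQuasiDensity_inter_residue_le h2 h3 h4 hk a X
    have hle := h3 (X ∩ {n | n % k = a}) (X \ {n | n % k = a})
    rw [Set.inter_union_sdiff] at hle
    rw [Finset.card_insert_of_notMem ha]
    push_cast
    rw [add_div]
    linarith

end UpperQuasiDensity

theorem stmt8 (μ : Set ℕ → ℝ)
    (h1 : μ Set.univ = 1)
    (h2 : ∀ X : Set ℕ, μ X ≤ 1)
    (h3 : ∀ X Y : Set ℕ, μ (X ∪ Y) ≤ μ X + μ Y)
    (h4 : ∀ (X : Set ℕ) (h k : ℕ), 0 < h → 0 < k →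
      μ (affImage k h X) = (1 / (k : ℝ)) * μ X)
    (X Y : Set ℕ) (hXY : X ⊆ Y)
    (k : ℕ) (hk : 0 < k) (H : Set ℕ) (hH : H ⊆ Set.Iio k)
    (hfin : (symmDiff Y (⋃ h ∈ H, affImage k h Set.univ)).Finite) :
    μ X ≤ μ Y := by
  classical
  obtain ⟨H, rfl⟩ := ((Set.finite_Iio k).subset hH).exists_finset_coe
  have hU : (⋃ h ∈ (H : Set ℕ), affImage k h Set.univ) = {n | n % k ∈ H} := by
    ext n
    simp only [affImage, Set.mem_iUnion, Set.mem_image, Set.mem_univ, true_and, Set.mem_ofPred_eq,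
      Finset.mem_coe, exists_prop]
    constructor
    · rintro ⟨h, hh, x, rfl⟩
      rwa [Nat.mul_add_mod, Nat.mod_eq_of_lt (hH hh)]
    · exact fun hn => ⟨n % k, hn, n / k, Nat.div_add_mod n k⟩
  rw [hU, Set.symmDiff_def] at hfin
  have hX := upperQuasiDensity_le_card_div h2 h3 h4 hk H X
    (hfin.subset fun n hn => Or.inl ⟨hXY hn.1, hn.2⟩)
  have hYc := upperQuasiDensity_le_card_div h2 h3 h4 hk (Finset.range k \ H) Yᶜ
    (hfin.subset fun n hn => Or.inr ⟨by
      by_contra h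
      exact hn.2 (Finset.mem_sdiff.2 ⟨Finset.mem_range.2 (Nat.mod_lt n hk), h⟩), hn.1⟩)
  have hHk : H ⊆ Finset.range k := fun h hh => Finset.mem_range.2 (hH hh)
  have hcard : ((Finset.range k \ H).card : ℝ) = k - H.card := by
    rw [Finset.cast_card_sdiff hHk, Finset.card_range]
  have hk0 : (k : ℝ) ≠ 0 := by positivity
  rw [hcard, sub_div, div_self hk0] at hYc
  have hle := h3 Y Yᶜ
  rw [Set.union_compl_self, h1] at hle
  linarith
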